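/- Fix r ≥ 0, y ∈ ℝ and constants a, b ≥ 0. Let f_n : [0,∞) × ℝ → [0,∞), n ≥ 0, be measurable functions with f₀ ≡ 0, and suppose that for every n ≥ 0 and every (t,x) ∈ [0,∞) × ℝ one has f_{n+1}(t,x) ≤ a · G_{t−r}(x−y) + b ∫_r^t ∫_ℝ G_{t−s}(x−w) f_n(s,w) dw ds (where the s-integral is over the interval (r,t) and is zero if t ≤ r). Then for every n ≥ 0 and every (t,x) ∈ [0,∞) × ℝ, f_n(t,x) ≤ a · e^{b t²} · G_{t−r}(x−y). -/

import Mathlib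

open MeasureTheory

/-- `G_t(x)`, the fundamental solution of the wave equation on `ℝ₊ × ℝ`:
`G_t(x) = 1/2` if `|x| < t`, and `0` otherwise (in particular `G_t ≡ 0` for `t ≤ 0`). -/
noncomputable def waveG (t x : ℝ) : ℝ := if |x| < t then 1 / 2 else 0

/-- Grönwall-type iteration for the wave kernel. If `f₀ ≡ 0` and
`f_{n+1}(t,x) ≤ a·G_{t−r}(x−y) + b ∫_r^t ∫_ℝ G_{t−s}(x−w) f_n(s,w) dw ds`, then
`f_n(t,x) ≤ a·e^{b t²}·G_{t−r}(x−y)` for all `n`, `t ≥ 0` and `x ∈ ℝ`. -/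
theorem stmt12 (r : ℝ) (hr : 0 ≤ r) (y : ℝ) (a b : ℝ) (ha : 0 ≤ a) (hb : 0 ≤ b)
    (f : ℕ → ℝ → ℝ → ℝ)
    (hmeas : ∀ n, Measurable (Function.uncurry (f n)))
    (hnonneg : ∀ n t x, 0 ≤ f n t x)
    (hf0 : ∀ t x, f 0 t x = 0)
    (hrec : ∀ n (t x : ℝ), 0 ≤ t →
      f (n + 1) t x ≤ a * waveG (t - r) (x - y)
        + b * ∫ s in Set.Ioo r t, ∫ w : ℝ, waveG (t - s) (x - w) * f n s w) :
    ∀ n (t x : ℝ), 0 ≤ t → f n t x ≤ a * Real.exp (b * t ^ 2) * waveG (t - r) (x - y) := by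
  intro n
  induction n with
  | zero =>
    intro t x _
    rw [hf0]
    have : 0 ≤ waveG (t - r) (x - y) := by unfold waveG; split_ifs <;> norm_num
    positivity
  | succ n ih =>
    intro t x ht
    have hG : ∀ u v, 0 ≤ waveG u v := by
      intro u v
      unfold waveG; split_ifs <;> norm_num
    refine (hrec n t x ht).trans ?_
    by_cases hxy : |x - y| < t - r
    · have hrt : r ≤ t := by linarith [abs_nonneg (x - y)]
      have hinner : ∀ s ∈ Set.Ioo r t,
          ∫ w : ℝ, waveG (t - s) (x - w) * f n s w ≤ a * (s * Real.exp (b * s ^ 2)) := by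
        intro s hs
        have hs0 : 0 ≤ s := hr.trans hs.1.le
        have h1 : ∫ w : ℝ, waveG (t - s) (x - w) * f n s w ≤
            ∫ w : ℝ, (Set.Ioo (y - (s - r)) (y + (s - r))).indicator
              (fun _ => a * Real.exp (b * s ^ 2) / 4) w := by
          apply integral_mono_of_nonneg
          · exact Filter.Eventually.of_forall fun w => mul_nonneg (hG _ _) (hnonneg _ _ _)
          · rw [integrable_indicator_iff measurableSet_Ioo]
            exact integrableOn_const (by simp)
          · refine Filter.Eventually.of_forall fun w => ?_
            have h2 := ih s w hs0
            have h3 : waveG (t - s) (x - w) ≤ 1 / 2 := by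
              unfold waveG; split_ifs <;> norm_num
            have h4 := mul_le_mul h3 h2 (hnonneg _ _ _) (by norm_num)
            refine h4.trans ?_
            by_cases hw : |w - y| < s - r
            · have hm : w ∈ Set.Ioo (y - (s - r)) (y + (s - r)) := by
                rw [abs_lt] at hw
                constructor <;> linarith
              rw [Set.indicator_of_mem hm]
              simp only [waveG, if_pos hw]
              linarith
            · simp only [waveG, if_neg hw, mul_zero]
              exact Set.indicator_nonneg (fun _ _ => by positivity) w
        refine h1.trans ?_
        rw [integral_indicator measurableSet_Ioo, setIntegral_const]
        have h5 : (volume : Measure ℝ).real (Set.Ioo (y - (s - r)) (y + (s - r)))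
            = 2 * (s - r) := by
          rw [Real.volume_real_Ioo_of_le (by linarith [hs.1])]
          ring
        rw [h5, smul_eq_mul]
        have h6 : 0 ≤ a * Real.exp (b * s ^ 2) := by positivity
        nlinarith [mul_nonneg h6 hs0, mul_nonneg h6 hr]
      have hcont : Continuous fun s : ℝ => a * (s * Real.exp (b * s ^ 2)) := by fun_prop
      have houter : ∫ s in Set.Ioo r t, ∫ w : ℝ, waveG (t - s) (x - w) * f n s w ≤
          ∫ s in Set.Ioo r t, a * (s * Real.exp (b * s ^ 2)) := by
        apply integral_mono_of_nonneg
        · exact Filter.Eventually.of_forall fun s =>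
            integral_nonneg fun w => mul_nonneg (hG _ _) (hnonneg _ _ _)
        · exact (hcont.integrableOn_Icc (a := r) (b := t)).mono_set Set.Ioo_subset_Icc_self
        · exact (ae_restrict_iff' measurableSet_Ioo).2 (Filter.Eventually.of_forall hinner)
      have hcalc : b * ∫ s in Set.Ioo r t, a * (s * Real.exp (b * s ^ 2)) =
          a / 2 * Real.exp (b * t ^ 2) - a / 2 * Real.exp (b * r ^ 2) := by
        rw [← integral_Ioc_eq_integral_Ioo, ← intervalIntegral.integral_of_le hrt,
          ← intervalIntegral.integral_const_mul]
        apply intervalIntegral.integral_eq_sub_of_hasDerivAt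
          (f := fun s => a / 2 * Real.exp (b * s ^ 2))
        · intro s _
          have := ((((hasDerivAt_id s).pow 2).const_mul b).exp).const_mul (a / 2)
          refine HasDerivAt.congr_deriv (this : HasDerivAt (fun s => a / 2 * Real.exp (b * s ^ 2)) _ s) ?_
          simp
          ring
        · exact (hcont.const_mul b).intervalIntegrable _ _
      have h7 := mul_le_mul_of_nonneg_left houter hb
      rw [hcalc] at h7
      have h8 : 1 ≤ Real.exp (b * r ^ 2) := Real.one_le_exp (by positivity)
      have h9 : a / 2 * 1 ≤ a / 2 * Real.exp (b * r ^ 2) :=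
        mul_le_mul_of_nonneg_left h8 (by positivity)
      have h10 : waveG (t - r) (x - y) = 1 / 2 := if_pos hxy
      rw [h10]
      linarith
    · have h0 : ∫ s in Set.Ioo r t, ∫ w : ℝ, waveG (t - s) (x - w) * f n s w = 0 := by
        apply setIntegral_eq_zero_of_forall_eq_zero
        intro s hs
        have hz : ∀ w, waveG (t - s) (x - w) * f n s w = 0 := by
          intro w
          by_cases hw : |w - y| < s - r
          · have : ¬ |x - w| < t - s := by
              intro h
              exact hxy (by linarith [abs_sub_le x w y])
            simp [waveG, this]
          · have h2 := ih s w (hr.trans hs.1.le)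
            simp only [waveG, if_neg hw, mul_zero] at h2
            rw [le_antisymm h2 (hnonneg _ _ _), mul_zero]
        simp [hz]
      have h10 : waveG (t - r) (x - y) = 0 := if_neg hxy
      rw [h0, h10]
      simp
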